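/- arXiv:1212.6100 — 2 statements merged into one kernel-verified Lean document; each statement's English description precedes it below -/
import Mathlib

section
/- Let θ > 0 and let μ_{V_θ}(dx) = C_θ e^{−|x| log^θ(1+|x|)} dx (i.e. V_θ(x) = |x| log^θ(1+|x|)). Then there exist positive constants c₃, c₄ such that the super Poincaré inequality μ_{V_θ}(f²) ≤ s · 𝓔_{α,V_θ}(f,f) + β(s) · μ_{V_θ}(|f|)² holds for all s > 0 and f ∈ C_b^∞(ℝ^d), with rate function β(s) = c₃ exp( 1 + e^{c₄ log^{1/θ}(1 + 1/s)} ). -/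
open MeasureTheory Real Set Metric Filter

noncomputable section

/-- Euclidean space `ℝ^d`. -/
abbrev Ed (d : ℕ) := EuclideanSpace ℝ (Fin d)

/-- The probability measure `μ_V(dx) = C_V e^{-V(x)} dx` with `C_V = (∫ e^{-V})⁻¹`. -/
def muV (d : ℕ) (V : Ed d → ℝ) : Measure (Ed d) :=
  (volume : Measure (Ed d)).withDensity
    fun x => ENNReal.ofReal ((∫ y, Real.exp (-V y))⁻¹ * Real.exp (-V x))

/-- `f ∈ C_b^∞(ℝ^d)`: smooth with bounded derivatives of every order. -/
def CbSmooth (d : ℕ) (f : Ed d → ℝ) : Prop :=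
  ContDiff ℝ (⊤ : ℕ∞) f ∧ ∀ n : ℕ, ∃ C : ℝ, ∀ x, ‖iteratedFDeriv ℝ n f x‖ ≤ C

/-- `V` is locally bounded. -/
def LocallyBounded (d : ℕ) (V : Ed d → ℝ) : Prop :=
  ∀ r : ℝ, ∃ M : ℝ, ∀ x : Ed d, ‖x‖ ≤ r → |V x| ≤ M

/-- The nonlocal Dirichlet form with finite range jumps `𝓔_{α,V}`. -/
def formE (d : ℕ) (α : ℝ) (V f : Ed d → ℝ) : ℝ :=
  (1/2) * ∫ x, (∫ y in {y : Ed d | dist x y ≤ 1},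
      (f x - f y) ^ 2 / dist x y ^ ((d : ℝ) + α)) ∂(muV d V)

/-- The nonlocal Dirichlet form with large jumps `𝓓_{α,V}`. -/
def formD (d : ℕ) (α : ℝ) (V f : Ed d → ℝ) : ℝ :=
  (1/2) * ∫ x, (∫ y in {y : Ed d | 1 < dist x y},
      (f x - f y) ^ 2 / dist x y ^ ((d : ℝ) + α)) ∂(muV d V)

/-- `inf_{z : |x|-1 ≤ |z| ≤ |x|-1/2} e^{-V(z)}`. -/
def infAnn (d : ℕ) (V : Ed d → ℝ) (x : Ed d) : ℝ :=
  sInf ((fun z => Real.exp (-V z)) '' {z : Ed d | ‖x‖ - 1 ≤ ‖z‖ ∧ ‖z‖ ≤ ‖x‖ - 1/2})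

/-- `sup_{z : |x| ≤ |z| ≤ |x|+1} e^{-V(z)}`. -/
def supAnn (d : ℕ) (V : Ed d → ℝ) (x : Ed d) : ℝ :=
  sSup ((fun z => Real.exp (-V z)) '' {z : Ed d | ‖x‖ ≤ ‖z‖ ∧ ‖z‖ ≤ ‖x‖ + 1})

/-- `K(r) = sup_{|x| ≤ r} e^{-V(x)}`. -/
def Kfun (d : ℕ) (V : Ed d → ℝ) (r : ℝ) : ℝ :=
  sSup ((fun x => Real.exp (-V x)) '' {x : Ed d | ‖x‖ ≤ r})

/-- `k(r) = inf_{|x| ≤ r+1} e^{-V(x)}`. -/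
def kfun (d : ℕ) (V : Ed d → ℝ) (r : ℝ) : ℝ :=
  sInf ((fun x => Real.exp (-V x)) '' {x : Ed d | ‖x‖ ≤ r + 1})

/-- The constant `(1/α)·2^{2d+1}·(e + e^{1/2})·(2^α − 1)`. -/
def thresholdConst (d : ℕ) (α : ℝ) : ℝ :=
  (1/α) * (2:ℝ) ^ (2*d+1) * (Real.exp 1 + Real.exp (1/2)) * ((2:ℝ) ^ α - 1)

/-- `V_θ(x) = |x| log^θ(1+|x|)`. -/
def Vtheta (d : ℕ) (θ : ℝ) : Ed d → ℝ := fun x => ‖x‖ * Real.log (1 + ‖x‖) ^ θ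

open scoped ENNReal

section JumpEnergy

variable {d : ℕ} {α : ℝ} {f : Ed d → ℝ} {ρ : Ed d → ℝ≥0∞}

/-- The finite range jump kernel `(f(x) - f(y))² |x - y|^{-(d+α)}`, cut off at `|x - y| ≤ 1`. -/
def jumpKernel (d : ℕ) (α : ℝ) (f : Ed d → ℝ) (x y : Ed d) : ℝ≥0∞ :=
  {p : Ed d × Ed d | dist p.1 p.2 ≤ 1}.indicator
    (fun p => ENNReal.ofReal ((f p.1 - f p.2) ^ 2 / dist p.1 p.2 ^ ((d : ℝ) + α))) (x, y)

/-- Twice the nonlocal form with respect to the measure with density `ρ`, as an extended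
nonnegative real. -/
def jumpEnergy (d : ℕ) (α : ℝ) (ρ : Ed d → ℝ≥0∞) (f : Ed d → ℝ) : ℝ≥0∞ :=
  ∫⁻ x, (∫⁻ y, jumpKernel d α f x y) * ρ x

lemma measurable_jumpKernel (hf : Measurable f) :
    Measurable (Function.uncurry (jumpKernel d α f)) := by
  have hs : MeasurableSet {p : Ed d × Ed d | dist p.1 p.2 ≤ 1} :=
    (isClosed_le (by fun_prop) continuous_const).measurableSet
  refine Measurable.indicator ?_ hs
  fun_prop

lemma jumpKernel_comm (x y : Ed d) : jumpKernel d α f x y = jumpKernel d α f y x := by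
  simp only [jumpKernel, indicator, mem_ofPred_eq, dist_comm y x, ← neg_sub (f x) (f y), neg_sq]

lemma enorm_sub_sq_le_jumpKernel (hα : 0 < α) {r : ℝ} (hr : r ≤ 1) {x y : Ed d}
    (hxy : dist x y ≤ r) :
    ‖f x - f y‖ₑ ^ 2 ≤ ENNReal.ofReal (r ^ ((d : ℝ) + α)) * jumpKernel d α f x y := by
  have h1 : ‖f x - f y‖ₑ ^ 2 = ENNReal.ofReal ((f x - f y) ^ 2) := by
    rw [← enorm_pow, Real.enorm_of_nonneg (sq_nonneg _)]
  rcases eq_or_ne x y with rfl | hne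
  · simp
  have hpos : 0 < dist x y := dist_pos.2 hne
  have hq : 0 < dist x y ^ ((d : ℝ) + α) := Real.rpow_pos_of_pos hpos _
  rw [h1, jumpKernel, indicator_of_mem (by exact hxy.trans hr),
    ← ENNReal.ofReal_mul (Real.rpow_nonneg (hpos.le.trans hxy) _)]
  refine ENNReal.ofReal_le_ofReal ?_
  rw [mul_div_assoc', le_div_iff₀ hq, mul_comm]
  exact mul_le_mul_of_nonneg_right (Real.rpow_le_rpow hpos.le hxy (by positivity)) (sq_nonneg _)

lemma enorm_sq_le_add_mul (a b : ℝ) : ‖a‖ₑ ^ 2 ≤ ‖a - b‖ₑ ^ 2 + 2 * ‖a‖ₑ * ‖b‖ₑ := by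
  have h : ENNReal.ofReal (|a| ^ 2) ≤ ENNReal.ofReal (|a - b| ^ 2 + 2 * |a| * |b|) := by
    refine ENNReal.ofReal_le_ofReal ?_
    rw [sq_abs, sq_abs, mul_assoc, ← abs_mul]
    nlinarith [le_abs_self (a * b), sq_nonneg b]
  rw [ENNReal.ofReal_add (by positivity) (by positivity), ENNReal.ofReal_mul (by positivity),
    ENNReal.ofReal_mul (by positivity), ENNReal.ofReal_pow (abs_nonneg _),
    ENNReal.ofReal_pow (abs_nonneg _)] at h
  simpa [Real.enorm_eq_ofReal_abs] using h

lemma enorm_sq_le_two_mul_add (a b : ℝ) : ‖a‖ₑ ^ 2 ≤ 2 * ‖a - b‖ₑ ^ 2 + 2 * ‖b‖ₑ ^ 2 := by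
  have h : ENNReal.ofReal (|a| ^ 2) ≤ ENNReal.ofReal (2 * |a - b| ^ 2 + 2 * |b| ^ 2) := by
    refine ENNReal.ofReal_le_ofReal ?_
    rw [sq_abs, sq_abs, sq_abs]
    nlinarith [sq_nonneg (a - 2 * b)]
  rw [ENNReal.ofReal_add (by positivity) (by positivity), ENNReal.ofReal_mul (by positivity),
    ENNReal.ofReal_mul (by positivity), ENNReal.ofReal_pow (abs_nonneg _),
    ENNReal.ofReal_pow (abs_nonneg _), ENNReal.ofReal_pow (abs_nonneg _)] at h
  simpa [Real.enorm_eq_ofReal_abs] using h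

/-- Local inequality: on a ball where `ρ` is bounded below, the second moment of `f` is controlled
by the jump energy at scale `r` and the first moment. -/
lemma lintegral_closedBall_sq_le (hα : 0 < α) (hf : Measurable f) (hρ : Measurable ρ)
    {r R : ℝ} (hr : r ≤ 1) {m : ℝ≥0∞} (hm : ∀ z : Ed d, ‖z‖ ≤ R + 1 → m ≤ ρ z) :
    m * volume (closedBall (0 : Ed d) r) * ∫⁻ x in closedBall 0 R, ‖f x‖ₑ ^ 2 * ρ x ≤
      m * ENNReal.ofReal (r ^ ((d : ℝ) + α)) * jumpEnergy d α ρ f +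
        2 * (∫⁻ x, ‖f x‖ₑ * ρ x) ^ 2 := by
  set A := ∫⁻ x, ‖f x‖ₑ * ρ x with hA
  set c := ENNReal.ofReal (r ^ ((d : ℝ) + α)) with hc
  have hJ : Measurable fun x => ∫⁻ y, jumpKernel d α f x y :=
    (measurable_jumpKernel hf).lintegral_prod_right
  have hJx (x : Ed d) : Measurable (jumpKernel d α f x) :=
    (measurable_jumpKernel hf).of_uncurry_left
  have key (x : Ed d) (hx : x ∈ closedBall (0 : Ed d) R) :
      m * volume (closedBall (0 : Ed d) r) * ‖f x‖ₑ ^ 2 ≤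
        m * c * (∫⁻ y, jumpKernel d α f x y) + 2 * ‖f x‖ₑ * A := by
    have h1 : m * ∫⁻ z in closedBall x r, ‖f z‖ₑ ≤ A := by
      rw [← lintegral_const_mul _ (by fun_prop)]
      refine (setLIntegral_mono' measurableSet_closedBall fun z hz => ?_).trans
        (setLIntegral_le_lintegral (closedBall x r) _)
      rw [mul_comm]
      refine mul_le_mul_right (hm z ?_) _
      have h2 := norm_le_norm_add_norm_sub x z
      rw [mem_closedBall, dist_zero_right] at hx
      rw [mem_closedBall, dist_eq_norm, norm_sub_rev] at hz
      linarith
    have h2 : volume (closedBall (0 : Ed d) r) * ‖f x‖ₑ ^ 2 ≤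
        c * (∫⁻ y, jumpKernel d α f x y) + 2 * ‖f x‖ₑ * ∫⁻ z in closedBall x r, ‖f z‖ₑ := by
      calc volume (closedBall (0 : Ed d) r) * ‖f x‖ₑ ^ 2
          = ∫⁻ _ in closedBall x r, ‖f x‖ₑ ^ 2 := by
            rw [setLIntegral_const, Measure.addHaar_closedBall_center _ x, mul_comm]
        _ ≤ ∫⁻ z in closedBall x r, (c * jumpKernel d α f x z + 2 * ‖f x‖ₑ * ‖f z‖ₑ) := by
            refine setLIntegral_mono' measurableSet_closedBall fun z hz => ?_
            refine (enorm_sq_le_add_mul (f x) (f z)).trans ?_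
            gcongr
            exact enorm_sub_sq_le_jumpKernel hα hr (by rwa [dist_comm])
        _ ≤ _ := by
            rw [lintegral_add_left ((hJx x).const_mul _), lintegral_const_mul _ (hJx x),
              lintegral_const_mul _ (by fun_prop)]
            gcongr
            exact Measure.restrict_le_self
    calc m * volume (closedBall (0 : Ed d) r) * ‖f x‖ₑ ^ 2
        ≤ m * (c * (∫⁻ y, jumpKernel d α f x y) +
            2 * ‖f x‖ₑ * ∫⁻ z in closedBall x r, ‖f z‖ₑ) := by
          rw [mul_assoc]; gcongr
      _ = m * c * (∫⁻ y, jumpKernel d α f x y) +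
            2 * ‖f x‖ₑ * (m * ∫⁻ z in closedBall x r, ‖f z‖ₑ) := by ring
      _ ≤ _ := by gcongr
  calc m * volume (closedBall (0 : Ed d) r) * ∫⁻ x in closedBall 0 R, ‖f x‖ₑ ^ 2 * ρ x
      = ∫⁻ x in closedBall 0 R, m * volume (closedBall (0 : Ed d) r) * (‖f x‖ₑ ^ 2 * ρ x) := by
        rw [lintegral_const_mul _ (by fun_prop)]
    _ ≤ ∫⁻ x in closedBall 0 R, (m * c * ((∫⁻ y, jumpKernel d α f x y) * ρ x) +
          2 * A * (‖f x‖ₑ * ρ x)) := by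
        refine setLIntegral_mono' measurableSet_closedBall fun x hx => ?_
        calc _ = m * volume (closedBall (0 : Ed d) r) * ‖f x‖ₑ ^ 2 * ρ x := by ring
          _ ≤ (m * c * (∫⁻ y, jumpKernel d α f x y) + 2 * ‖f x‖ₑ * A) * ρ x := by
            gcongr; exact key x hx
          _ = _ := by ring
    _ ≤ ∫⁻ x, (m * c * ((∫⁻ y, jumpKernel d α f x y) * ρ x) + 2 * A * (‖f x‖ₑ * ρ x)) :=
        setLIntegral_le_lintegral _ _
    _ = m * c * jumpEnergy d α ρ f + 2 * A ^ 2 := by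
        rw [lintegral_add_left (by fun_prop), lintegral_const_mul _ (by fun_prop),
          lintegral_const_mul _ (by fun_prop), ← hA, jumpEnergy]
        ring

/-- Tail inequality: if `ρ` decays by a factor `ε` along inward jumps from outside the ball of
radius `R`, then the second moment of `f` there is controlled by `ε` times the jump energy and the
full second moment. -/
lemma lintegral_compl_closedBall_sq_le (hα : 0 < α) (hf : Measurable f) (hρ : Measurable ρ)
    {R : ℝ} (hR : 1 ≤ R) {ε : ℝ≥0∞}
    (hε : ∀ x z : Ed d, R ≤ ‖x‖ → ‖z‖ ≤ ‖x‖ - 1 / 2 → ρ x ≤ ε * ρ z) :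
    volume (closedBall (0 : Ed d) (1 / 4)) * ∫⁻ x in (closedBall 0 R)ᶜ, ‖f x‖ₑ ^ 2 * ρ x ≤
      2 * ε * (jumpEnergy d α ρ f +
        volume (closedBall (0 : Ed d) 1) * ∫⁻ x, ‖f x‖ₑ ^ 2 * ρ x) := by
  have hK := measurable_jumpKernel (α := α) hf
  set D : Set (Ed d × Ed d) := {p | dist p.1 p.2 ≤ 1} with hD
  have hDm : MeasurableSet D := (isClosed_le (by fun_prop) continuous_const).measurableSet
  set g : Ed d → Ed d → ℝ≥0∞ := fun x z =>
    jumpKernel d α f x z * ρ z + D.indicator (fun p => ‖f p.2‖ₑ ^ 2 * ρ p.2) (x, z) with hg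
  have hgm : Measurable (Function.uncurry g) := by
    refine (hK.mul (hρ.comp measurable_snd)).add (Measurable.indicator ?_ hDm)
    fun_prop
  have key (x : Ed d) (hx : x ∈ (closedBall (0 : Ed d) R)ᶜ) :
      volume (closedBall (0 : Ed d) (1 / 4)) * (‖f x‖ₑ ^ 2 * ρ x) ≤
        2 * ε * ∫⁻ z, g x z := by
    have hxR : R < ‖x‖ := by simpa using hx
    have hx0 : ‖x‖ ≠ 0 := by linarith
    set w : Ed d := x - (3 / 4 / ‖x‖) • x with hw
    have hxw : ‖x - w‖ = 3 / 4 := by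
      rw [hw, sub_sub_cancel, norm_smul, Real.norm_of_nonneg (by positivity),
        div_mul_cancel₀ _ hx0]
    have hwn : ‖w‖ = ‖x‖ - 3 / 4 := by
      have : w = (1 - 3 / 4 / ‖x‖) • x := by rw [hw, sub_smul, one_smul]
      rw [this, norm_smul, Real.norm_of_nonneg, sub_mul, div_mul_cancel₀ _ hx0, one_mul]
      rw [sub_nonneg, div_le_one (by positivity)]; linarith
    calc volume (closedBall (0 : Ed d) (1 / 4)) * (‖f x‖ₑ ^ 2 * ρ x)
        = ∫⁻ _ in closedBall w (1 / 4), ‖f x‖ₑ ^ 2 * ρ x := by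
          rw [setLIntegral_const, Measure.addHaar_closedBall_center _ w, mul_comm]
      _ ≤ ∫⁻ z in closedBall w (1 / 4), 2 * ε * g x z := by
          refine setLIntegral_mono' measurableSet_closedBall fun z hz => ?_
          rw [mem_closedBall, dist_eq_norm] at hz
          have hzx : dist x z ≤ 1 := by
            rw [dist_eq_norm]
            have := norm_sub_le_norm_sub_add_norm_sub x w z
            rw [norm_sub_rev w z] at this
            linarith
          have hzn : ‖z‖ ≤ ‖x‖ - 1 / 2 := by
            have := norm_le_norm_add_norm_sub w z
            rw [norm_sub_rev w z] at this
            linarith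
          have h1 : ‖f x - f z‖ₑ ^ 2 ≤ jumpKernel d α f x z := by
            simpa using enorm_sub_sq_le_jumpKernel (f := f) hα le_rfl hzx
          have h2 : g x z = jumpKernel d α f x z * ρ z + ‖f z‖ₑ ^ 2 * ρ z := by
            simp only [hg]; rw [indicator_of_mem (by exact hzx)]
          rw [h2]
          calc ‖f x‖ₑ ^ 2 * ρ x
              ≤ (2 * jumpKernel d α f x z + 2 * ‖f z‖ₑ ^ 2) * (ε * ρ z) := by
                gcongr
                · exact (enorm_sq_le_two_mul_add (f x) (f z)).trans (by gcongr)
                · exact hε x z hxR.le hzn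
            _ = _ := by ring
      _ ≤ ∫⁻ z, 2 * ε * g x z := setLIntegral_le_lintegral _ _
      _ = _ := lintegral_const_mul _ (hgm.of_uncurry_left)
  have htotal : ∫⁻ x, ∫⁻ z, g x z = jumpEnergy d α ρ f +
      volume (closedBall (0 : Ed d) 1) * ∫⁻ x, ‖f x‖ₑ ^ 2 * ρ x := by
    have hL : Measurable fun x => (∫⁻ y, jumpKernel d α f x y) * ρ x :=
      hK.lintegral_prod_right.mul hρ
    rw [lintegral_lintegral_swap hgm.aemeasurable, jumpEnergy, ← lintegral_const_mul _ (by fun_prop),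
      ← lintegral_add_left hL]
    refine lintegral_congr fun z => ?_
    have hKz : Measurable fun x => jumpKernel d α f x z := hK.of_uncurry_right
    simp only [hg]
    rw [lintegral_add_left (hKz.mul_const _), lintegral_mul_const _ hKz]
    congr 1
    · simp_rw [jumpKernel_comm z]
    · have : (fun x => D.indicator (fun p => ‖f p.2‖ₑ ^ 2 * ρ p.2) (x, z)) =
          (closedBall z 1).indicator fun _ => ‖f z‖ₑ ^ 2 * ρ z := by
        ext x
        simp [indicator, hD]
      rw [this, lintegral_indicator measurableSet_closedBall, setLIntegral_const,
        Measure.addHaar_closedBall_center, mul_comm]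
  calc volume (closedBall (0 : Ed d) (1 / 4)) * ∫⁻ x in (closedBall 0 R)ᶜ, ‖f x‖ₑ ^ 2 * ρ x
      = ∫⁻ x in (closedBall 0 R)ᶜ,
          volume (closedBall (0 : Ed d) (1 / 4)) * (‖f x‖ₑ ^ 2 * ρ x) := by
        rw [lintegral_const_mul _ (by fun_prop)]
    _ ≤ ∫⁻ x in (closedBall 0 R)ᶜ, 2 * ε * ∫⁻ z, g x z :=
        setLIntegral_mono' measurableSet_closedBall.compl key
    _ ≤ ∫⁻ x, 2 * ε * ∫⁻ z, g x z := setLIntegral_le_lintegral _ _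
    _ = _ := by
        rw [lintegral_const_mul _ hgm.lintegral_prod_right, htotal]

end JumpEnergy

section RealValued

variable {d : ℕ} {α : ℝ} {f : Ed d → ℝ}

lemma lintegral_closedBall_rpow_norm_lt_top (hd : 1 ≤ d) {q : ℝ} (hq : -(d : ℝ) < q) :
    ∫⁻ y : Ed d, (closedBall 0 1).indicator (fun y => ENNReal.ofReal (‖y‖ ^ q)) y < ∞ := by
  have : Nonempty (Fin d) := ⟨⟨0, hd⟩⟩
  have hint : Integrable (fun x : Ed d => (Iic (1 : ℝ)).indicator (fun t => t ^ q) ‖x‖) := by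
    rw [integrable_fun_norm_addHaar volume, finrank_euclideanSpace_fin]
    have h1 : IntegrableOn (fun t : ℝ => t ^ ((d : ℝ) - 1 + q)) (Ioc 0 1) := by
      have := intervalIntegral.intervalIntegrable_rpow' (a := 0) (b := 1)
        (r := (d : ℝ) - 1 + q) (by linarith)
      rwa [intervalIntegrable_iff_integrableOn_Ioc_of_le zero_le_one] at this
    have h2 : EqOn (fun t : ℝ => t ^ (d - 1) • (Iic (1 : ℝ)).indicator (fun t => t ^ q) t)
        ((Ioc (0 : ℝ) 1).indicator fun t : ℝ => t ^ ((d : ℝ) - 1 + q)) (Ioi 0) := by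
      intro t ht
      rw [mem_Ioi] at ht
      by_cases h : t ≤ 1
      · simp only [smul_eq_mul]
        rw [indicator_of_mem (show t ∈ Iic (1 : ℝ) from h),
          indicator_of_mem (show t ∈ Ioc (0 : ℝ) 1 from ⟨ht, h⟩), Real.rpow_add ht]
        congr 1
        rw [← Real.rpow_natCast, Nat.cast_sub hd, Nat.cast_one]
      · simp [indicator, h]
    rw [integrableOn_congr_fun h2 measurableSet_Ioi]
    exact (h1.integrable_indicator measurableSet_Ioc).integrableOn
  refine lt_of_le_of_lt (lintegral_mono fun y => ?_) hint.lintegral_lt_top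
  by_cases h : ‖y‖ ≤ 1 <;> simp [indicator, h]

lemma CbSmooth.exists_bound (hf : CbSmooth d f) : ∃ C : ℝ, ∀ x, ‖f x‖ ≤ C := by
  obtain ⟨C, hC⟩ := hf.2 0
  exact ⟨C, fun x => by simpa only [norm_iteratedFDeriv_zero] using hC x⟩

lemma CbSmooth.exists_lipschitz (hf : CbSmooth d f) :
    ∃ L : ℝ, ∀ x y, |f x - f y| ≤ L * dist x y := by
  obtain ⟨L, hL⟩ := hf.2 1
  refine ⟨L, fun x y => ?_⟩
  rw [dist_eq_norm, ← Real.norm_eq_abs]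
  exact convex_univ.norm_image_sub_le_of_norm_fderiv_le (𝕜 := ℝ)
    (fun z _ => (hf.1.differentiable (by simp)).differentiableAt)
    (fun z _ => by simpa only [norm_iteratedFDeriv_one] using hL z) (mem_univ y) (mem_univ x)

lemma CbSmooth.exists_lintegral_jumpKernel_le (hf : CbSmooth d f) (hd : 1 ≤ d) (hα : α < 2) :
    ∃ K : ℝ≥0∞, K < ∞ ∧ ∀ x, ∫⁻ y, jumpKernel d α f x y ≤ K := by
  obtain ⟨L, hL⟩ := hf.exists_lipschitz
  set q : ℝ := 2 - ((d : ℝ) + α) with hq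
  refine ⟨ENNReal.ofReal (L ^ 2) * ∫⁻ y : Ed d,
    (closedBall 0 1).indicator (fun y => ENNReal.ofReal (‖y‖ ^ q)) y, ENNReal.mul_lt_top
      ENNReal.ofReal_lt_top (lintegral_closedBall_rpow_norm_lt_top hd (by linarith)), fun x => ?_⟩
  rw [← lintegral_sub_right_eq_self
    ((closedBall (0 : Ed d) 1).indicator fun y => ENNReal.ofReal (‖y‖ ^ q)) x, ← lintegral_const_mul' _ _ ENNReal.ofReal_ne_top]
  refine lintegral_mono fun y => ?_
  by_cases h : dist x y ≤ 1
  · rw [jumpKernel, indicator_of_mem (by exact h), indicator_of_mem (by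
      rwa [mem_closedBall, dist_zero_right, ← dist_eq_norm, dist_comm]),
      ← ENNReal.ofReal_mul (sq_nonneg _), ← dist_eq_norm, dist_comm y x]
    refine ENNReal.ofReal_le_ofReal ?_
    rcases eq_or_ne x y with rfl | hne
    · simp only [sub_self]
      rw [zero_pow two_ne_zero, zero_div]
      positivity
    have hpos : 0 < dist x y := dist_pos.2 hne
    rw [hq, Real.rpow_sub hpos, mul_div_assoc']
    gcongr
    rw [Real.rpow_two, ← mul_pow, ← sq_abs]
    exact pow_le_pow_left₀ (abs_nonneg _) (hL x y) 2
  · rw [jumpKernel, indicator_of_notMem (by exact h)]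
    exact zero_le

/-- The density of `muV d V` with respect to Lebesgue measure. -/
def muVDensity (d : ℕ) (V : Ed d → ℝ) (x : Ed d) : ℝ≥0∞ :=
  ENNReal.ofReal ((∫ y, Real.exp (-V y))⁻¹ * Real.exp (-V x))

variable {V : Ed d → ℝ}

lemma measurable_muVDensity (hV : Measurable V) : Measurable (muVDensity d V) := by
  unfold muVDensity; fun_prop

lemma lintegral_muV (hV : Measurable V) {g : Ed d → ℝ≥0∞} (hg : Measurable g) :
    ∫⁻ x, g x ∂(muV d V) = ∫⁻ x, g x * muVDensity d V x := by
  have := lintegral_withDensity_eq_lintegral_mul volume (measurable_muVDensity hV) hg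
  simp only [Pi.mul_apply, mul_comm (muVDensity d V _)] at this
  exact this

lemma lintegral_muVDensity_lt_top (hint : Integrable fun x => Real.exp (-V x)) :
    ∫⁻ x, muVDensity d V x < ∞ :=
  (hint.const_mul _).lintegral_lt_top

lemma lintegral_mul_muVDensity_lt_top (hint : Integrable fun x => Real.exp (-V x))
    {g : Ed d → ℝ≥0∞} {K : ℝ≥0∞} (hK : K < ∞) (hg : ∀ x, g x ≤ K) :
    ∫⁻ x, g x * muVDensity d V x < ∞ := by
  refine lt_of_le_of_lt (lintegral_mono fun x => mul_le_mul_left (hg x) _) ?_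
  rw [lintegral_const_mul' _ _ hK.ne]
  exact ENNReal.mul_lt_top hK (lintegral_muVDensity_lt_top hint)

lemma CbSmooth.formE_eq (hf : CbSmooth d f) (hd : 1 ≤ d) (hα : α < 2) (hV : Measurable V) :
    formE d α V f = 1 / 2 * (jumpEnergy d α (muVDensity d V) f).toReal := by
  have hfm : Measurable f := hf.1.continuous.measurable
  obtain ⟨K, hK, hle⟩ := hf.exists_lintegral_jumpKernel_le (α := α) hd hα
  have hJ : Measurable fun x => ∫⁻ y, jumpKernel d α f x y :=
    (measurable_jumpKernel hfm).lintegral_prod_right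
  have hin (x : Ed d) : (∫ y in {y : Ed d | dist x y ≤ 1},
      (f x - f y) ^ 2 / dist x y ^ ((d : ℝ) + α)) = (∫⁻ y, jumpKernel d α f x y).toReal := by
    have hs : MeasurableSet {y : Ed d | dist x y ≤ 1} :=
      (isClosed_le (by fun_prop) continuous_const).measurableSet
    rw [integral_eq_lintegral_of_nonneg_ae (ae_of_all _ fun y => by positivity)
      (Measurable.aestronglyMeasurable (by fun_prop)), ← lintegral_indicator hs]
    rfl
  rw [formE, jumpEnergy, ← lintegral_muV hV hJ]
  simp_rw [hin]
  rw [integral_toReal hJ.aemeasurable (ae_of_all _ fun x => (hle x).trans_lt hK)]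

lemma integral_muV_eq_toReal (hV : Measurable V) {g : Ed d → ℝ} (hg : Measurable g)
    (h0 : ∀ x, 0 ≤ g x) :
    ∫ x, g x ∂(muV d V) = (∫⁻ x, ENNReal.ofReal (g x) * muVDensity d V x).toReal := by
  rw [integral_eq_lintegral_of_nonneg_ae (ae_of_all _ h0) hg.aestronglyMeasurable,
    lintegral_muV hV (by fun_prop)]

/-- Combination of the local and the tail inequality for `muV d V`. -/
lemma CbSmooth.integral_sq_le (hf : CbSmooth d f) (hd : 1 ≤ d) (hα : 0 < α) (hα2 : α < 2)
    (hV : Measurable V) (hint : Integrable fun x => Real.exp (-V x)) {r R m ε : ℝ} (hr0 : 0 < r)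
    (hr : r ≤ 1) (hR : 1 ≤ R) (hm0 : 0 < m)
    (hm : ∀ z : Ed d, ‖z‖ ≤ R + 1 → m ≤ (∫ y, Real.exp (-V y))⁻¹ * Real.exp (-V z))
    (hε0 : 0 ≤ ε) (hε1 : 4 * 4 ^ d * ε ≤ 1)
    (hε : ∀ x z : Ed d, R ≤ ‖x‖ → ‖z‖ ≤ ‖x‖ - 1 / 2 →
      Real.exp (-V x) ≤ ε * Real.exp (-V z)) :
    ∫ x, f x ^ 2 ∂(muV d V) ≤
      (4 * r ^ α + 8 * 4 ^ d * ε) / volume.real (closedBall (0 : Ed d) 1) * formE d α V f +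
        4 / (m * volume.real (closedBall (0 : Ed d) 1) * r ^ d) *
          (∫ x, |f x| ∂(muV d V)) ^ 2 := by
  have hfm : Measurable f := hf.1.continuous.measurable
  have hρ := measurable_muVDensity (d := d) hV
  set ρ := muVDensity d V with hρdef
  have hZ : 0 ≤ (∫ y, Real.exp (-V y))⁻¹ :=
    inv_nonneg.2 (integral_nonneg fun y => (Real.exp_pos _).le)
  have hloc := lintegral_closedBall_sq_le (ρ := ρ) (m := ENNReal.ofReal m) hα hfm hρ hr
    (fun z hz => ENNReal.ofReal_le_ofReal (hm z hz))
  have htail := lintegral_compl_closedBall_sq_le (ρ := ρ) (ε := ENNReal.ofReal ε) hα hfm hρ hR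
    (fun x z hx hz => by
      rw [hρdef, muVDensity, muVDensity, ← ENNReal.ofReal_mul hε0]
      refine ENNReal.ofReal_le_ofReal ?_
      rw [mul_left_comm]
      exact mul_le_mul_of_nonneg_left (hε x z hx hz) hZ)
  obtain ⟨C, hC⟩ := hf.exists_bound
  obtain ⟨K, hK, hle⟩ := hf.exists_lintegral_jumpKernel_le (α := α) hd hα2
  have hCe (x : Ed d) : ‖f x‖ₑ ≤ ENNReal.ofReal C := by
    rw [← ofReal_norm]; exact ENNReal.ofReal_le_ofReal (hC x)
  have hG : jumpEnergy d α ρ f ≠ ∞ := (lintegral_mul_muVDensity_lt_top hint hK hle).ne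
  have hA : ∫⁻ x, ‖f x‖ₑ * ρ x ≠ ∞ :=
    (lintegral_mul_muVDensity_lt_top hint ENNReal.ofReal_lt_top hCe).ne
  have hM : ∫⁻ x, ‖f x‖ₑ ^ 2 * ρ x ≠ ∞ :=
    (lintegral_mul_muVDensity_lt_top hint (K := ENNReal.ofReal C ^ 2)
      (ENNReal.pow_lt_top ENNReal.ofReal_lt_top) (fun x => by gcongr; exact hCe x)).ne
  have hsplit := lintegral_add_compl (μ := volume) (fun x => ‖f x‖ₑ ^ 2 * ρ x)
    (measurableSet_closedBall (x := (0 : Ed d)) (ε := R))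
  rw [hf.formE_eq hd hα2 hV, integral_muV_eq_toReal hV (by fun_prop) (fun x => sq_nonneg _),
    integral_muV_eq_toReal hV (by fun_prop) (fun x => abs_nonneg _)]
  have e1 (x : Ed d) : ENNReal.ofReal (f x ^ 2) = ‖f x‖ₑ ^ 2 := by
    rw [← enorm_pow, Real.enorm_of_nonneg (sq_nonneg _)]
  simp_rw [e1, ← Real.enorm_eq_ofReal_abs]
  set G := jumpEnergy d α ρ f
  set A := ∫⁻ x, ‖f x‖ₑ * ρ x
  set M := ∫⁻ x, ‖f x‖ₑ ^ 2 * ρ x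
  set M₁ := ∫⁻ x in closedBall 0 R, ‖f x‖ₑ ^ 2 * ρ x
  set M₂ := ∫⁻ x in (closedBall 0 R)ᶜ, ‖f x‖ₑ ^ 2 * ρ x
  have hM1 : M₁ ≠ ∞ := ne_top_of_le_ne_top hM (hsplit ▸ le_self_add)
  have hM2 : M₂ ≠ ∞ := ne_top_of_le_ne_top hM (hsplit ▸ le_add_self)
  have hv : volume (closedBall (0 : Ed d) 1) ≠ ∞ := measure_closedBall_lt_top.ne
  have hω : 0 < volume.real (closedBall (0 : Ed d) 1) :=
    ENNReal.toReal_pos (measure_closedBall_pos _ _ one_pos).ne' hv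
  rw [Measure.addHaar_closedBall' volume _ hr0.le, finrank_euclideanSpace_fin] at hloc
  rw [Measure.addHaar_closedBall' volume (0 : Ed d) (r := 1 / 4) (by norm_num),
    finrank_euclideanSpace_fin] at htail
  replace hloc := ENNReal.toReal_mono (by finiteness) hloc
  replace htail := ENNReal.toReal_mono (by finiteness) htail
  replace hsplit := congrArg ENNReal.toReal hsplit
  rw [ENNReal.toReal_add hM1 hM2] at hsplit
  rw [ENNReal.toReal_add (by finiteness) (by finiteness)] at hloc
  simp only [ENNReal.toReal_mul, ENNReal.toReal_pow, ENNReal.toReal_ofNat,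
    ENNReal.toReal_add hG (by finiteness : volume (closedBall (0 : Ed d) 1) * M ≠ ∞),
    ENNReal.toReal_ofReal hm0.le, ENNReal.toReal_ofReal hε0,
    ENNReal.toReal_ofReal (pow_nonneg hr0.le d),
    ENNReal.toReal_ofReal (Real.rpow_nonneg hr0.le ((d : ℝ) + α)),
    ENNReal.toReal_ofReal (by positivity : (0 : ℝ) ≤ (1 / 4) ^ d)] at hloc htail
  simp only [← measureReal_def] at hloc htail
  set ω := volume.real (closedBall (0 : Ed d) 1)
  have hrd : 0 < r ^ d := pow_pos hr0 d
  rw [Real.rpow_add hr0, Real.rpow_natCast] at hloc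
  have h1 : M₁.toReal ≤ r ^ α / ω * G.toReal + 2 / (m * ω * r ^ d) * A.toReal ^ 2 := by
    refine le_of_mul_le_mul_left ?_ (by positivity : 0 < m * (r ^ d * ω))
    refine hloc.trans_eq ?_
    field_simp
  have h2 : M₂.toReal ≤ 2 * 4 ^ d * ε / ω * G.toReal + 2 * 4 ^ d * ε * M.toReal := by
    refine le_of_mul_le_mul_left ?_ (by positivity : 0 < (1 / 4 : ℝ) ^ d * ω)
    refine htail.trans_eq ?_
    rw [one_div, inv_pow]
    field_simp
  have h3 : 2 * 4 ^ d * ε * M.toReal ≤ 1 / 2 * M.toReal := by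
    gcongr; linarith
  have h4 : (4 * r ^ α + 8 * 4 ^ d * ε) / ω * (1 / 2 * G.toReal) +
      4 / (m * ω * r ^ d) * A.toReal ^ 2 =
      2 * ((r ^ α / ω * G.toReal + 2 / (m * ω * r ^ d) * A.toReal ^ 2) +
        2 * 4 ^ d * ε / ω * G.toReal) := by
    ring
  rw [h4]
  linarith

end RealValued

section Vtheta

variable {d : ℕ} {θ : ℝ}

lemma measurable_Vtheta : Measurable (Vtheta d θ) := by
  unfold Vtheta; fun_prop

lemma Vtheta_le (hθ : 0 < θ) {R : ℝ} {z : Ed d} (hz : ‖z‖ ≤ R) :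
    Vtheta d θ z ≤ R * Real.log (1 + R) ^ θ := by
  have h0 := norm_nonneg z
  have hl : 0 ≤ Real.log (1 + ‖z‖) := Real.log_nonneg (by linarith)
  have hR : 0 ≤ R := h0.trans hz
  unfold Vtheta
  gcongr

lemma exp_neg_Vtheta_le (hθ : 0 < θ) {R : ℝ} (hR : 1 ≤ R) {x z : Ed d} (hx : R ≤ ‖x‖)
    (hz : ‖z‖ ≤ ‖x‖ - 1 / 2) :
    Real.exp (-Vtheta d θ x) ≤
      Real.exp (-(Real.log (1 + R) ^ θ / 2)) * Real.exp (-Vtheta d θ z) := by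
  rw [← Real.exp_add, Real.exp_le_exp]
  have h0 := norm_nonneg z
  have hl : 0 ≤ Real.log (1 + R) := Real.log_nonneg (by linarith)
  have hlz : 0 ≤ Real.log (1 + ‖z‖) := Real.log_nonneg (by linarith)
  have h1 : Real.log (1 + R) ^ θ ≤ Real.log (1 + ‖x‖) ^ θ := by gcongr
  have h2 : Vtheta d θ z ≤ (‖x‖ - 1 / 2) * Real.log (1 + ‖x‖) ^ θ := by
    unfold Vtheta
    have h3 : ‖z‖ ≤ ‖x‖ := by linarith
    have h4 : 0 ≤ ‖x‖ - 1 / 2 := h0.trans hz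
    gcongr
  have h3 : Vtheta d θ x = ‖x‖ * Real.log (1 + ‖x‖) ^ θ := rfl
  linarith

/-- Growth of the local rate in terms of `log (1 + 1/s)`. -/
lemma exists_rate_bound (hθ : 0 < θ) {K b : ℝ} (hK : Real.exp 1 ≤ K) (hb : 0 ≤ b) :
    ∃ c : ℝ, 0 < c ∧ ∀ s : ℝ, 0 < s → s ≤ 1 →
      Real.exp ((2 * Real.log (K / s)) ^ (1 / θ)) *
          Real.log (1 + Real.exp ((2 * Real.log (K / s)) ^ (1 / θ))) ^ θ + b * -Real.log s ≤
        Real.exp (c * Real.log (1 + 1 / s) ^ (1 / θ)) := by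
  have hl2 : 0 < Real.log 2 := Real.log_pos one_lt_two
  have hK0 : 0 < K := (Real.exp_pos 1).trans_le hK
  have hlK : 1 ≤ Real.log K := (Real.le_log_iff_exp_le hK0).2 hK
  set C : ℝ := Real.log K / Real.log 2 + 1 with hC
  have hC0 : 0 < C := by positivity
  set D : ℝ := 2 ^ θ * (2 * C) + b with hD
  have hD0 : 0 < D := by positivity
  set v₀ : ℝ := Real.log 2 ^ (1 / θ) with hv0
  have hv0p : 0 < v₀ := by positivity
  refine ⟨(2 * C) ^ (1 / θ) + θ + D / v₀, by positivity, fun s hs hs1 => ?_⟩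
  set u := Real.log (1 + 1 / s) with hu
  have h1s : 1 ≤ 1 / s := by rwa [le_div_iff₀ hs, one_mul]
  have hu2 : Real.log 2 ≤ u := Real.log_le_log two_pos (by linarith)
  have hu0 : 0 < u := hl2.trans_le hu2
  set v := u ^ (1 / θ) with hv
  have hvv : v₀ ≤ v := Real.rpow_le_rpow hl2.le hu2 (by positivity)
  have hv' : 0 < v := hv0p.trans_le hvv
  have huv : u ≤ Real.exp (θ * v) := by
    have h1 : u = v ^ θ := by
      rw [hv, ← Real.rpow_mul hu0.le, one_div_mul_cancel hθ.ne', Real.rpow_one]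
    have h2 : v ≤ Real.exp v := by linarith [Real.add_one_le_exp v]
    calc u = v ^ θ := h1
      _ ≤ Real.exp v ^ θ := by gcongr
      _ = Real.exp (θ * v) := by rw [← Real.exp_mul, mul_comm]
  have hns : -Real.log s ≤ u := by
    rw [← Real.log_inv, ← one_div]
    exact Real.log_le_log (by positivity) (by linarith)
  have hlog : Real.log (K / s) = Real.log K - Real.log s := Real.log_div hK0.ne' hs.ne'
  have hls : Real.log s ≤ 0 := Real.log_nonpos hs.le hs1
  have hlC : Real.log (K / s) ≤ C * u := by
    have : Real.log K ≤ Real.log K / Real.log 2 * u := by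
      rw [div_mul_eq_mul_div, le_div_iff₀ hl2]
      gcongr
    rw [hlog, hC, add_mul]
    linarith
  have hl1 : 1 ≤ Real.log (K / s) := by rw [hlog]; linarith
  set T := (2 * Real.log (K / s)) ^ (1 / θ) with hT
  have hT1 : 1 ≤ T := Real.one_le_rpow (by linarith) (by positivity)
  have hTv : T ≤ (2 * C) ^ (1 / θ) * v := by
    rw [hv, ← Real.mul_rpow (by positivity) hu0.le, hT]
    exact Real.rpow_le_rpow (by linarith) (by linarith) (by positivity)
  have hTθ : T ^ θ = 2 * Real.log (K / s) := by
    rw [hT, ← Real.rpow_mul (by linarith), one_div_mul_cancel hθ.ne', Real.rpow_one]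
  have hlT : Real.log (1 + Real.exp T) ≤ 2 * T := by
    rw [Real.log_le_iff_le_exp (by positivity), two_mul, Real.exp_add]
    have := Real.add_one_le_exp T
    nlinarith
  have hlT0 : 0 ≤ Real.log (1 + Real.exp T) :=
    Real.log_nonneg (by linarith [Real.exp_pos T])
  have hlTθ : Real.log (1 + Real.exp T) ^ θ ≤ 2 ^ θ * (2 * C) * Real.exp (θ * v) := by
    calc Real.log (1 + Real.exp T) ^ θ ≤ (2 * T) ^ θ := by gcongr
      _ = 2 ^ θ * (2 * Real.log (K / s)) := by rw [Real.mul_rpow two_pos.le (by linarith), hTθ]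
      _ ≤ 2 ^ θ * (2 * (C * Real.exp (θ * v))) := by
        have : C * u ≤ C * Real.exp (θ * v) := by gcongr
        gcongr
        linarith
      _ = _ := by ring
  have hDv : D ≤ Real.exp (D / v₀ * v) := by
    have : D ≤ D / v₀ * v := by
      rw [div_mul_eq_mul_div, le_div_iff₀ hv0p]
      gcongr
    linarith [Real.add_one_le_exp (D / v₀ * v)]
  have hE1 : 1 ≤ Real.exp ((2 * C) ^ (1 / θ) * v) := Real.one_le_exp (by positivity)
  calc Real.exp T * Real.log (1 + Real.exp T) ^ θ + b * -Real.log s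
      ≤ Real.exp ((2 * C) ^ (1 / θ) * v) * (2 ^ θ * (2 * C) * Real.exp (θ * v)) +
        b * Real.exp (θ * v) := by
        gcongr
        exact hns.trans huv
    _ ≤ Real.exp ((2 * C) ^ (1 / θ) * v) * (2 ^ θ * (2 * C) * Real.exp (θ * v)) +
        Real.exp ((2 * C) ^ (1 / θ) * v) * (b * Real.exp (θ * v)) := by
        exact add_le_add le_rfl (le_mul_of_one_le_left (by positivity) hE1)
    _ = Real.exp ((2 * C) ^ (1 / θ) * v) * Real.exp (θ * v) * D := by rw [hD]; ring
    _ ≤ Real.exp ((2 * C) ^ (1 / θ) * v) * Real.exp (θ * v) * Real.exp (D / v₀ * v) := by gcongr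
    _ = _ := by rw [← Real.exp_add, ← Real.exp_add]; ring_nf

/-- The super Poincaré inequality for `Vtheta` at small `s`. -/
lemma exists_super_poincare_Vtheta_of_le (hd : 1 ≤ d) {α : ℝ} (hα : 0 < α) (hα2 : α < 2)
    (hθ : 0 < θ) (hint : Integrable fun x => Real.exp (-Vtheta d θ x)) :
    ∃ s₀ c₃ c₄ : ℝ, 0 < s₀ ∧ 0 < c₃ ∧ 0 < c₄ ∧ ∀ s : ℝ, 0 < s → s ≤ s₀ →
      ∀ f : Ed d → ℝ, CbSmooth d f →
        ∫ x, (f x) ^ 2 ∂(muV d (Vtheta d θ)) ≤ s * formE d α (Vtheta d θ) f +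
          (c₃ * Real.exp (1 + Real.exp (c₄ * Real.log (1 + 1/s) ^ (1/θ)))) *
          (∫ x, |f x| ∂(muV d (Vtheta d θ))) ^ 2 := by
  set ω := volume.real (closedBall (0 : Ed d) 1) with hωdef
  have hω : 0 < ω := ENNReal.toReal_pos (measure_closedBall_pos _ _ one_pos).ne'
    measure_closedBall_lt_top.ne
  set Z := ∫ y, Real.exp (-Vtheta d θ y) with hZdef
  have hZ : 0 < Z := integral_exp_pos hint
  set K : ℝ := 4 * 4 ^ d + 16 * 4 ^ d / ω with hKdef
  have hK4 : 4 * 4 ^ d ≤ K := by rw [hKdef]; linarith [(by positivity : 0 < 16 * 4 ^ d / ω)]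
  have hK16 : 16 * 4 ^ d ≤ K * ω := by
    rw [hKdef, add_mul, div_mul_cancel₀ _ hω.ne']
    linarith [(by positivity : 0 < 4 * 4 ^ d * ω)]
  have hKe : Real.exp 1 ≤ K := by
    have : (1 : ℝ) ≤ 4 ^ d := one_le_pow₀ (by norm_num)
    linarith [Real.exp_one_lt_d9]
  have hK0 : 0 < K := (Real.exp_pos 1).trans_le hKe
  set b : ℝ := (d : ℝ) / α with hb
  obtain ⟨c₄, hc₄, hrate⟩ := exists_rate_bound (b := b) hθ hKe (by positivity)
  refine ⟨min 1 (8 / ω), 4 * Z / (ω * (ω / 8) ^ b), c₄, by positivity, by positivity, hc₄,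
    fun s hs hs0 f hf => ?_⟩
  have hs1 : s ≤ 1 := hs0.trans (min_le_left _ _)
  have hsω : ω / 8 * s ≤ 1 := by
    have := hs0.trans (min_le_right _ _)
    rw [le_div_iff₀ hω] at this
    linarith
  set T := (2 * Real.log (K / s)) ^ (1 / θ) with hT
  have hKs : 0 < K / s := by positivity
  have hl1 : 1 ≤ Real.log (K / s) := by
    rw [Real.le_log_iff_exp_le hKs, le_div_iff₀ hs]
    exact (mul_le_of_le_one_right (Real.exp_pos 1).le hs1).trans hKe
  have hT1 : 1 ≤ T := Real.one_le_rpow (by linarith) (by positivity)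
  have hTθ : T ^ θ = 2 * Real.log (K / s) := by
    rw [hT, ← Real.rpow_mul (by linarith), one_div_mul_cancel hθ.ne', Real.rpow_one]
  set R := Real.exp T - 1 with hR
  have hR1 : 1 ≤ R := by linarith [Real.add_one_le_exp T]
  have hε : Real.exp (-(Real.log (1 + R) ^ θ / 2)) = s / K := by
    rw [hR, add_sub_cancel, Real.log_exp, hTθ, mul_div_cancel_left₀ _ two_ne_zero, Real.exp_neg,
      Real.exp_log hKs, inv_div]
  set W := Real.exp T * Real.log (1 + Real.exp T) ^ θ with hW
  set r := (ω / 8 * s) ^ (1 / α) with hr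
  have hr0 : 0 < r := by positivity
  have hrα : r ^ α = ω / 8 * s := by
    rw [hr, ← Real.rpow_mul (by positivity), one_div_mul_cancel hα.ne', Real.rpow_one]
  have hrd : r ^ d = (ω / 8) ^ b * Real.exp (b * Real.log s) := by
    rw [hr, ← Real.rpow_natCast, ← Real.rpow_mul (by positivity), Real.mul_rpow (by positivity) hs.le,
      Real.rpow_def_of_pos hs, one_div_mul_eq_div, ← hb, mul_comm b]
  have hmain := hf.integral_sq_le hd hα hα2 measurable_Vtheta hint (r := r) (R := R)
    (m := Z⁻¹ * Real.exp (-W)) (ε := s / K) hr0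
    (Real.rpow_le_one (by positivity) hsω (by positivity)) hR1 (by positivity)
    (fun z hz => by
      rw [hR, sub_add_cancel] at hz
      have := Vtheta_le hθ hz
      gcongr)
    (by positivity)
    (by
      rw [mul_div_assoc', div_le_one hK0]
      exact (mul_le_of_le_one_right (by positivity) hs1).trans hK4)
    (fun x z hx hz => hε ▸ exp_neg_Vtheta_le hθ hR1 hx hz)
  rw [← hωdef] at hmain
  have hE : 0 ≤ formE d α (Vtheta d θ) f := by
    rw [hf.formE_eq hd hα2 measurable_Vtheta]
    positivity
  refine hmain.trans (add_le_add (mul_le_mul_of_nonneg_right ?_ hE)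
    (mul_le_mul_of_nonneg_right ?_ (sq_nonneg _)))
  · rw [hrα, div_le_iff₀ hω]
    have : 8 * 4 ^ d * (s / K) ≤ s * ω / 2 := by
      rw [mul_div_assoc', div_le_iff₀ hK0]
      nlinarith
    linarith
  · have h1 : 4 / (Z⁻¹ * Real.exp (-W) * ω * r ^ d) =
        4 * Z / (ω * (ω / 8) ^ b) * Real.exp (W + b * -Real.log s) := by
      rw [hrd, Real.exp_add, mul_neg, Real.exp_neg, Real.exp_neg]
      field_simp
    rw [h1]
    refine mul_le_mul_of_nonneg_left (Real.exp_le_exp.2 ?_) (by positivity)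
    have := hrate s hs hs1
    linarith

end Vtheta

/-- super Poincaré inequality for `μ_{V_θ}(dx) = C_θ e^{-|x|log^θ(1+|x|)} dx`
with `θ > 0`, with rate function `β(s) = c₃ exp(1 + e^{c₄ log^{1/θ}(1+1/s)})`. -/
theorem super_poincare_Vtheta
    (d : ℕ) (hd : 1 ≤ d) (α : ℝ) (hα : 0 < α ∧ α < 2)
    (θ : ℝ) (hθ : 0 < θ) :
    ∃ c₃ c₄ : ℝ, 0 < c₃ ∧ 0 < c₄ ∧ ∀ s : ℝ, 0 < s → ∀ f : Ed d → ℝ, CbSmooth d f →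
      ∫ x, (f x) ^ 2 ∂(muV d (Vtheta d θ)) ≤ s * formE d α (Vtheta d θ) f +
        (c₃ * Real.exp (1 + Real.exp (c₄ * Real.log (1 + 1/s) ^ (1/θ)))) *
        (∫ x, |f x| ∂(muV d (Vtheta d θ))) ^ 2 := by
  by_cases hint : Integrable fun x => Real.exp (-Vtheta d θ x)
  · obtain ⟨s₀, c₃, c₄, hs₀, hc₃, hc₄, h⟩ :=
      exists_super_poincare_Vtheta_of_le hd hα.1 hα.2 hθ hint
    set β₀ := Real.exp (1 + Real.exp (c₄ * Real.log (1 + 1/s₀) ^ (1/θ))) with hβ₀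
    have hβ1 : 1 ≤ β₀ := Real.one_le_exp (by positivity)
    refine ⟨c₃ * β₀, c₄, by positivity, hc₄, fun s hs f hf => ?_⟩
    rcases le_total s s₀ with hle | hle
    · refine (h s hs hle f hf).trans ?_
      gcongr
      exact le_mul_of_one_le_right hc₃.le hβ1
    · have hE : 0 ≤ formE d α (Vtheta d θ) f := by
        rw [hf.formE_eq hd hα.2 measurable_Vtheta]
        positivity
      refine (h s₀ hs₀ le_rfl f hf).trans ?_
      rw [← hβ₀]
      refine add_le_add (mul_le_mul_of_nonneg_right hle hE)
        (mul_le_mul_of_nonneg_right ?_ (sq_nonneg _))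
      exact le_mul_of_one_le_right (by positivity) (Real.one_le_exp (by positivity))
  · have hμ : muV d (Vtheta d θ) = 0 := by
      simp [muV, integral_undef hint]
    refine ⟨1, 1, one_pos, one_pos, fun s _ f _ => ?_⟩
    simp [formE, hμ]
end
end

section
/- Let θ ∈ ℝ and μ_{V_θ}(dx) = C_θ e^{−|x| log^θ(1+|x|)} dx (i.e. V_θ(x) = |x| log^θ(1+|x|)). (i) If θ ≤ 0, then the super Poincaré inequality μ_{V_θ}(f²) ≤ s · 𝓔_{α,V_θ}(f,f) + β(s) · μ_{V_θ}(|f|)² (for all s > 0 and f ∈ C_b^∞(ℝ^d)) fails for every decreasing rate function β : (0,∞) → (0,∞). (ii) If θ > 0, then the super Poincaré inequality does not hold with any decreasing rate function β satisfying lim_{s→0} log log β(s) / log^{1/θ}(1 + s^{−1}) = 0. -/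
open MeasureTheory Real Set Metric Filter

noncomputable section

/-- The radial cutoff vanishing on the ball of radius `R` and equal to `1` outside the ball of
radius `R + 1`. -/
def radialCutoff (d : ℕ) (R : ℝ) : Ed d → ℝ := fun x => smoothTransition (‖x‖ - R)

theorem exists_lipschitzWith_smoothTransition :
    ∃ L : NNReal, LipschitzWith L smoothTransition := by
  have hc : HasCompactSupport (deriv smoothTransition) := by
    refine HasCompactSupport.intro (isCompact_Icc (a := (0 : ℝ)) (b := 1)) fun x hx => ?_
    rcases lt_or_ge x 0 with h | h
    · have : smoothTransition =ᶠ[nhds x] fun _ => 0 := by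
        filter_upwards [Iio_mem_nhds h] with y hy
        exact smoothTransition.zero_of_nonpos (le_of_lt hy)
      simp [this.deriv_eq]
    · have h1 : 1 < x := by
        by_contra! h1
        exact hx ⟨h, h1⟩
      have : smoothTransition =ᶠ[nhds x] fun _ => 1 := by
        filter_upwards [Ioi_mem_nhds h1] with y hy
        exact smoothTransition.one_of_one_le (le_of_lt hy)
      simp [this.deriv_eq]
  have hs : ContDiff ℝ 1 smoothTransition := smoothTransition.contDiff
  obtain ⟨C, hC⟩ := (hs.continuous_deriv le_rfl).bounded_above_of_compact_support hc
  refine ⟨C.toNNReal, lipschitzWith_of_nnnorm_deriv_le (hs.differentiable one_ne_zero) fun x => ?_⟩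
  rw [← NNReal.coe_le_coe]
  exact (hC x).trans (le_coe_toNNReal C)

theorem contDiff_radialCutoff (d : ℕ) {R : ℝ} (hR : 0 < R) :
    ContDiff ℝ (⊤ : ℕ∞) (radialCutoff d R) := by
  refine contDiff_iff_contDiffAt.2 fun x => ?_
  by_cases hx : x = 0
  · subst hx
    have : radialCutoff d R =ᶠ[nhds 0] fun _ => 0 := by
      filter_upwards [ball_mem_nhds (0 : Ed d) hR] with y hy
      rw [mem_ball_zero_iff] at hy
      exact smoothTransition.zero_of_nonpos (by linarith)
    exact contDiffAt_const.congr_of_eventuallyEq this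
  · exact smoothTransition.contDiffAt.comp x ((contDiffAt_norm ℝ hx).sub contDiffAt_const)

theorem cbSmooth_radialCutoff (d : ℕ) {R : ℝ} (hR : 0 < R) : CbSmooth d (radialCutoff d R) := by
  have hf := contDiff_radialCutoff d hR
  refine ⟨hf, fun n => ?_⟩
  set g : Ed d → ℝ := fun x => 1 - radialCutoff d R x with hg
  have hgs : ContDiff ℝ (⊤ : ℕ∞) g := contDiff_const.sub hf
  have hgc : HasCompactSupport g := by
    refine HasCompactSupport.intro (isCompact_closedBall (0 : Ed d) (R + 1)) fun x hx => ?_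
    rw [mem_closedBall_zero_iff, not_le] at hx
    simp [hg, radialCutoff, smoothTransition.one_of_one_le (x := ‖x‖ - R) (by linarith)]
  have hn : (n : WithTop ℕ∞) ≤ ((⊤ : ℕ∞) : WithTop ℕ∞) := by exact_mod_cast le_top
  obtain ⟨C, hC⟩ := (hgs.continuous_iteratedFDeriv hn).bounded_above_of_compact_support
    (hgc.iteratedFDeriv n)
  refine ⟨1 + C, fun x => ?_⟩
  have hfg : radialCutoff d R = fun x => (fun _ : Ed d => (1 : ℝ)) x - g x := by
    ext x
    simp [hg]
  rw [hfg, fun_iteratedFDeriv_sub_apply contDiffAt_const (hgs.of_le hn).contDiffAt]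
  refine (norm_sub_le _ _).trans (add_le_add ?_ (hC x))
  rcases eq_or_ne n 0 with rfl | h
  · simp
  · simp [iteratedFDeriv_const_of_ne h]

theorem radialCutoff_eq_zero {d : ℕ} {R : ℝ} {x : Ed d} (h : ‖x‖ ≤ R) : radialCutoff d R x = 0 :=
  smoothTransition.zero_of_nonpos (by linarith)

theorem radialCutoff_eq_one {d : ℕ} {R : ℝ} {x : Ed d} (h : R + 1 ≤ ‖x‖) :
    radialCutoff d R x = 1 :=
  smoothTransition.one_of_one_le (by linarith)

theorem abs_radialCutoff_le {d : ℕ} (R : ℝ) (x : Ed d) : |radialCutoff d R x| ≤ 1 :=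
  (abs_of_nonneg (smoothTransition.nonneg (‖x‖ - R))).trans_le (smoothTransition.le_one _)

theorem exists_abs_radialCutoff_sub_le (d : ℕ) : ∃ L : ℝ, 0 ≤ L ∧ ∀ (R : ℝ) (x y : Ed d),
    |radialCutoff d R x - radialCutoff d R y| ≤ L * dist x y := by
  obtain ⟨L, hL⟩ := exists_lipschitzWith_smoothTransition
  refine ⟨L, L.2, fun R x y => ?_⟩
  rw [← Real.dist_eq]
  refine (hL.dist_le_mul _ _).trans (mul_le_mul_of_nonneg_left ?_ L.2)
  rw [Real.dist_eq, dist_eq_norm]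
  simpa using abs_norm_sub_norm_le x y

theorem integrableOn_ball_norm_rpow {d : ℕ} (hd : 1 ≤ d) {p : ℝ} (hp : 0 < p + d) (r : ℝ) :
    IntegrableOn (fun z : Ed d => ‖z‖ ^ p) (ball 0 r) := by
  have : Nontrivial (Ed d) := by
    have : Nonempty (Fin d) := ⟨⟨0, hd⟩⟩
    infer_instance
  refine (integrableOn_fun_norm_addHaar volume (f := fun t : ℝ => t ^ p)).2 ?_
  rcases le_or_gt r 0 with hr | hr
  · simp [hr]
  refine ((intervalIntegral.integrableOn_Ioo_rpow_iff (s := p + d - 1) hr).2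
    (by linarith)).congr_fun (fun t ht => ?_) measurableSet_Ioo
  simp only [finrank_euclideanSpace, Fintype.card_fin, smul_eq_mul]
  rw [← rpow_natCast, ← rpow_add ht.1, Nat.cast_sub hd]
  congr 1
  push_cast
  ring

/-- The energy of the radial cutoffs is controlled by the mass of the tails. -/
theorem exists_formE_radialCutoff_le {d : ℕ} (hd : 1 ≤ d) {α : ℝ} (hα : α < 2) (V : Ed d → ℝ)
    [IsFiniteMeasure (muV d V)] : ∃ C : ℝ, 0 < C ∧ ∀ R : ℝ,
      formE d α V (radialCutoff d R) ≤ C * (muV d V).real {x | R - 1 < ‖x‖} := by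
  obtain ⟨L, hL0, hL⟩ := exists_abs_radialCutoff_sub_le d
  set k : Ed d → ℝ := (ball (0 : Ed d) 2).indicator fun z => L ^ 2 * ‖z‖ ^ (2 - (d + α)) with hk
  have hki : Integrable k := by
    rw [hk, integrable_indicator_iff measurableSet_ball]
    exact (integrableOn_ball_norm_rpow hd (by linarith) 2).const_mul _
  have hk0 : ∀ z, 0 ≤ k z := indicator_nonneg fun z _ => by positivity
  have hK0 : 0 ≤ ∫ z, k z := integral_nonneg hk0
  have hbound : ∀ R (x : Ed d), (∫ y in {y : Ed d | dist x y ≤ 1},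
      (radialCutoff d R x - radialCutoff d R y) ^ 2 / dist x y ^ ((d : ℝ) + α)) ≤
        {x : Ed d | R - 1 < ‖x‖}.indicator (fun _ => ∫ z, k z) x := by
    intro R x
    have hS : MeasurableSet {y : Ed d | dist x y ≤ 1} :=
      (isClosed_le (by fun_prop) (by fun_prop)).measurableSet
    by_cases hx : R - 1 < ‖x‖
    · rw [indicator_of_mem (by exact hx), ← integral_sub_left_eq_self k volume x,
        ← integral_indicator hS]
      refine integral_mono_of_nonneg (.of_forall ?_) (hki.comp_sub_left x) (.of_forall ?_)
      · exact indicator_nonneg fun y _ => by positivity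
      · intro y
        refine indicator_le' (fun y hy => ?_) (fun y _ => hk0 _) y
        have hy' : dist x y ≤ 1 := hy
        have hmem : x - y ∈ ball (0 : Ed d) 2 := by
          rw [mem_ball_zero_iff, ← dist_eq_norm]
          linarith
        rw [hk, indicator_of_mem hmem, ← dist_eq_norm]
        rcases eq_or_ne x y with rfl | hxy
        · rw [sub_self, zero_pow two_ne_zero, zero_div]
          positivity
        · have hpos : 0 < dist x y := dist_pos.2 hxy
          rw [rpow_sub hpos, rpow_two, ← mul_div_assoc, ← mul_pow]
          refine div_le_div_of_nonneg_right ?_ (by positivity)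
          rw [← sq_abs]
          exact pow_le_pow_left₀ (abs_nonneg _) (hL R x y) 2
    · rw [indicator_of_notMem (by exact hx)]
      rw [not_lt] at hx
      refine (setIntegral_eq_zero_of_forall_eq_zero fun y hy => ?_).le
      have hy' : dist x y ≤ 1 := hy
      have hyR : ‖y‖ ≤ R := by
        have := norm_sub_norm_le y x
        rw [← dist_eq_norm, dist_comm] at this
        linarith
      rw [radialCutoff_eq_zero (by linarith), radialCutoff_eq_zero hyR]
      simp
  refine ⟨(∫ z, k z) + 1, by linarith, fun R => ?_⟩
  have hmeas : MeasurableSet {x : Ed d | R - 1 < ‖x‖} :=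
    (isOpen_lt (by fun_prop) (by fun_prop)).measurableSet
  have h : (∫ x, (∫ y in {y : Ed d | dist x y ≤ 1},
      (radialCutoff d R x - radialCutoff d R y) ^ 2 / dist x y ^ ((d : ℝ) + α)) ∂(muV d V)) ≤
        (muV d V).real {x | R - 1 < ‖x‖} * ∫ z, k z := by
    have := integral_mono_of_nonneg (μ := muV d V)
      (.of_forall fun x => integral_nonneg fun y => by positivity)
      ((integrable_const (∫ z, k z)).indicator hmeas) (.of_forall (hbound R))
    rwa [integral_indicator_const _ hmeas, smul_eq_mul] at this
  have hT : 0 ≤ (muV d V).real {x | R - 1 < ‖x‖} := measureReal_nonneg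
  unfold formE
  nlinarith [mul_nonneg hT hK0]

/-- A super Poincaré inequality implies a recursive inequality between tails. -/
theorem exists_tail_recursion {d : ℕ} (hd : 1 ≤ d) {α : ℝ} (hα : α < 2) (V : Ed d → ℝ)
    [IsFiniteMeasure (muV d V)] {β : ℝ → ℝ} (hβ : ∀ s, 0 < s → 0 < β s)
    (h : ∀ s : ℝ, 0 < s → ∀ f : Ed d → ℝ, CbSmooth d f →
      ∫ x, (f x) ^ 2 ∂(muV d V) ≤ s * formE d α V f + β s * (∫ x, |f x| ∂(muV d V)) ^ 2) :
    ∃ C : ℝ, 0 < C ∧ ∀ R s : ℝ, 0 < R → 0 < s →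
      (muV d V).real {x | R + 1 < ‖x‖} ≤ s * C * (muV d V).real {x | R - 1 < ‖x‖} +
        β s * (muV d V).real {x | R < ‖x‖} ^ 2 := by
  obtain ⟨C, hC, hE⟩ := exists_formE_radialCutoff_le hd hα V
  refine ⟨C, hC, fun R s hR hs => ?_⟩
  have hmeas : ∀ r : ℝ, MeasurableSet {x : Ed d | r < ‖x‖} := fun r =>
    (isOpen_lt (by fun_prop) (by fun_prop)).measurableSet
  have hint : ∀ r : ℝ, (muV d V).real {x | r < ‖x‖} =
      ∫ x, {x : Ed d | r < ‖x‖}.indicator (fun _ => (1 : ℝ)) x ∂(muV d V) := fun r => by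
    rw [integral_indicator_const _ (hmeas r), smul_eq_mul, mul_one]
  have hfc : Continuous (radialCutoff d R) := (contDiff_radialCutoff d hR).continuous
  have h1 : (muV d V).real {x | R + 1 < ‖x‖} ≤ ∫ x, (radialCutoff d R x) ^ 2 ∂(muV d V) := by
    rw [hint]
    refine integral_mono_of_nonneg (.of_forall (indicator_nonneg fun _ _ => zero_le_one)) ?_
      (.of_forall fun x => indicator_le' (fun x hx => ?_) (fun x _ => sq_nonneg _) x)
    · refine Integrable.of_bound (hfc.pow 2).aestronglyMeasurable 1 (.of_forall fun x => ?_)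
      rw [norm_pow]
      exact pow_le_one₀ (norm_nonneg _) (abs_radialCutoff_le R x)
    · simp [radialCutoff_eq_one (le_of_lt hx)]
  have h2 : ∫ x, |radialCutoff d R x| ∂(muV d V) ≤ (muV d V).real {x | R < ‖x‖} := by
    rw [hint]
    refine integral_mono_of_nonneg (.of_forall fun x => abs_nonneg _)
      ((integrable_const _).indicator (hmeas R)) (.of_forall fun x => ?_)
    by_cases hx : R < ‖x‖
    · simpa [indicator_of_mem (show x ∈ {x : Ed d | R < ‖x‖} from hx)]
        using abs_radialCutoff_le R x
    · simp [radialCutoff_eq_zero (not_lt.1 hx), hx]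
  have h3 : (∫ x, |radialCutoff d R x| ∂(muV d V)) ^ 2 ≤ (muV d V).real {x | R < ‖x‖} ^ 2 :=
    pow_le_pow_left₀ (integral_nonneg fun x => abs_nonneg _) h2 2
  calc _ ≤ _ := h1
    _ ≤ _ := h s hs _ (cbSmooth_radialCutoff d hR)
    _ ≤ s * (C * (muV d V).real {x | R - 1 < ‖x‖}) + β s * (muV d V).real {x | R < ‖x‖} ^ 2 :=
      add_le_add (mul_le_mul_of_nonneg_left (hE R) hs.le)
        (mul_le_mul_of_nonneg_left h3 (hβ s hs).le)
    _ = _ := by ring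

/-- Once the tail is small, the recursive inequality forces geometric decay. -/
theorem tail_geometric_decay {T : ℝ → ℝ} (hT0 : ∀ r, 0 ≤ T r) (hT : Antitone T) {a b r : ℝ}
    (ha : 0 < a) (hb : 0 < b) (hr : 0 ≤ r)
    (h : ∀ R, 0 < R → T (R + 1) ≤ a * T (R - 1) + b * T R ^ 2) (hsmall : b * T r ≤ a) (k : ℕ) :
    T (r + 2 * k) ≤ (2 * a) ^ k * T r := by
  induction k with
  | zero => simp
  | succ k ih =>
    have h1 := h (r + 2 * k + 1) (by positivity)
    rw [show r + 2 * (k : ℝ) + 1 - 1 = r + 2 * k by ring,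
      show r + 2 * (k : ℝ) + 1 + 1 = r + 2 * ((k + 1 : ℕ) : ℝ) by push_cast; ring] at h1
    have h2 : T (r + 2 * k + 1) ≤ T (r + 2 * k) := hT (by linarith)
    have h3 : T (r + 2 * k + 1) ≤ T r := hT (by have : (0 : ℝ) ≤ k := k.cast_nonneg; linarith)
    have h4 : b * T (r + 2 * k + 1) ^ 2 ≤ a * T (r + 2 * k) :=
      calc b * T (r + 2 * k + 1) ^ 2 = b * T (r + 2 * k + 1) * T (r + 2 * k + 1) := by ring
        _ ≤ b * T r * T (r + 2 * k) := mul_le_mul (mul_le_mul_of_nonneg_left h3 hb.le) h2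
            (hT0 _) (mul_nonneg hb.le (hT0 _))
        _ ≤ a * T (r + 2 * k) := mul_le_mul_of_nonneg_right hsmall (hT0 _)
    calc _ ≤ 2 * a * T (r + 2 * k) := by linarith
      _ ≤ 2 * a * ((2 * a) ^ k * T r) := mul_le_mul_of_nonneg_left ih (by positivity)
      _ = _ := by ring

theorem integrable_exp_neg_norm (d : ℕ) {u : ℝ → ℝ} (hu : Measurable u)
    (hu0 : ∀ t, 0 ≤ t → 0 ≤ u t) (hlog : ∀ᶠ t in atTop, (d + 1 : ℝ) * Real.log (1 + t) ≤ u t) :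
    Integrable fun x : Ed d => Real.exp (-u ‖x‖) := by
  obtain ⟨t₀, ht₀⟩ := eventually_atTop.1 hlog
  have hdim : (Module.finrank ℝ (Ed d) : ℝ) < d + 1 := by simp
  refine ((integrable_one_add_norm (μ := volume) hdim).const_mul
    ((1 + max t₀ 0) ^ (d + 1 : ℝ))).mono'
      (hu.comp measurable_norm).neg.exp.aestronglyMeasurable (.of_forall fun x => ?_)
  have hx : 0 < 1 + ‖x‖ := by positivity
  have hm : (1 : ℝ) ≤ 1 + max t₀ 0 := by simp
  rw [norm_of_nonneg (exp_pos _).le]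
  rcases le_or_gt t₀ ‖x‖ with h | h
  · have h1 : Real.exp (-u ‖x‖) ≤ (1 + ‖x‖) ^ (-(d + 1 : ℝ)) := by
      rw [rpow_def_of_pos hx]
      exact Real.exp_le_exp.2 (by linarith [ht₀ _ h])
    refine h1.trans (le_mul_of_one_le_left (by positivity) (one_le_rpow hm (by positivity)))
  · have h1 : (1 + ‖x‖) ^ (d + 1 : ℝ) ≤ (1 + max t₀ 0) ^ (d + 1 : ℝ) :=
      rpow_le_rpow hx.le (by linarith [le_max_left t₀ 0]) (by positivity)
    rw [rpow_neg hx.le, ← div_eq_mul_inv]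
    refine (Real.exp_le_one_iff.2 (by linarith [hu0 _ (norm_nonneg x)])).trans ?_
    rwa [one_le_div (by positivity)]

theorem isFiniteMeasure_muV {d : ℕ} {V : Ed d → ℝ} (hV : Integrable fun x => Real.exp (-V x)) :
    IsFiniteMeasure (muV d V) :=
  isFiniteMeasure_withDensity_ofReal (hV.const_mul _).2

theorem muV_real_apply {d : ℕ} {V : Ed d → ℝ} (hV : Integrable fun x => Real.exp (-V x))
    {S : Set (Ed d)} (hS : MeasurableSet S) :
    (muV d V).real S = (∫ y, Real.exp (-V y))⁻¹ * ∫ x in S, Real.exp (-V x) := by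
  have hZ : 0 ≤ (∫ y, Real.exp (-V y))⁻¹ := inv_nonneg.2 (integral_nonneg fun _ => (exp_pos _).le)
  rw [← integral_const_mul, Measure.real, muV, withDensity_apply _ hS,
    integral_eq_lintegral_of_nonneg_ae
      (.of_forall fun x => mul_nonneg hZ (exp_pos _).le) (hV.const_mul _).1.restrict]

theorem measurableSet_norm_gt {d : ℕ} (r : ℝ) : MeasurableSet {x : Ed d | r < ‖x‖} :=
  (isOpen_lt continuous_const continuous_norm).measurableSet

theorem exists_tail_lower_bound {d : ℕ} (hd : 1 ≤ d) {V : Ed d → ℝ}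
    (hV : Integrable fun x => Real.exp (-V x)) : ∃ c : ℝ, 0 < c ∧ ∀ R B : ℝ, 0 ≤ R →
      (∀ x, R < ‖x‖ → ‖x‖ < R + 1 → V x ≤ B) →
      c * Real.exp (-B) ≤ (muV d V).real {x | R < ‖x‖} := by
  have hv : 0 < volume.real (ball (0 : Ed d) (1 / 2)) :=
    ENNReal.toReal_pos (measure_ball_pos _ _ (by norm_num)).ne' measure_ball_lt_top.ne
  have hZ : 0 < (∫ y, Real.exp (-V y))⁻¹ := inv_pos.2 (integral_exp_pos hV)
  refine ⟨(∫ y, Real.exp (-V y))⁻¹ * volume.real (ball (0 : Ed d) (1 / 2)), by positivity,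
    fun R B hR hB => ?_⟩
  rw [muV_real_apply hV (measurableSet_norm_gt R), mul_assoc]
  refine mul_le_mul_of_nonneg_left ?_ hZ.le
  set p : Ed d := EuclideanSpace.single ⟨0, hd⟩ (R + 1 / 2) with hp
  have hpn : ‖p‖ = R + 1 / 2 := by
    rw [hp, PiLp.norm_single, norm_of_nonneg (by positivity)]
  have hball : ∀ x ∈ ball p (1 / 2), R < ‖x‖ ∧ ‖x‖ < R + 1 := fun x hx => by
    rw [mem_ball, dist_eq_norm] at hx
    have h1 := abs_norm_sub_norm_le x p
    have h2 := abs_le.1 h1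
    constructor <;> linarith [h2.1, h2.2]
  have hvol : volume.real (ball (0 : Ed d) (1 / 2)) = volume.real (ball p (1 / 2)) := by
    rw [Measure.real, Measure.real, Measure.addHaar_ball_center volume p]
  calc volume.real (ball (0 : Ed d) (1 / 2)) * Real.exp (-B)
      = ∫ _ in ball p (1 / 2), Real.exp (-B) := by rw [setIntegral_const, smul_eq_mul, hvol]
    _ ≤ ∫ x in ball p (1 / 2), Real.exp (-V x) :=
      setIntegral_mono_on (integrableOn_const measure_ball_lt_top.ne) hV.integrableOn
        measurableSet_ball fun x hx => Real.exp_le_exp.2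
          (neg_le_neg (hB x (hball x hx).1 (hball x hx).2))
    _ ≤ _ := setIntegral_mono_set hV.integrableOn (.of_forall fun x => (exp_pos _).le)
      (LE.le.eventuallyLE fun x hx => (hball x hx).1)

theorem antitone_tail {d : ℕ} (V : Ed d → ℝ) [IsFiniteMeasure (muV d V)] :
    Antitone fun r : ℝ => (muV d V).real {x | r < ‖x‖} :=
  fun _ _ h => measureReal_mono fun _ hx => lt_of_le_of_lt h hx

theorem tendsto_tail {d : ℕ} (V : Ed d → ℝ) [IsFiniteMeasure (muV d V)] :
    Tendsto (fun n : ℕ => (muV d V).real {x | (n : ℝ) < ‖x‖}) atTop (nhds 0) := by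
  have h := tendsto_measure_iInter_atTop (μ := muV d V)
    (s := fun n : ℕ => {x : Ed d | (n : ℝ) < ‖x‖})
    (fun n => (measurableSet_norm_gt _).nullMeasurableSet)
    (fun m n hmn x (hx : (n : ℝ) < ‖x‖) => lt_of_le_of_lt (Nat.cast_le.2 hmn) hx)
    ⟨0, measure_ne_top _ _⟩
  have he : ⋂ n : ℕ, {x : Ed d | (n : ℝ) < ‖x‖} = ∅ := by
    refine eq_empty_of_forall_notMem fun x hx => ?_
    obtain ⟨n, hn⟩ := exists_nat_ge ‖x‖
    exact absurd (mem_iInter.1 hx n) (not_lt.2 hn)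
  rw [he, measure_empty] at h
  exact (ENNReal.tendsto_toReal ENNReal.zero_ne_top).comp h

/-- A super Poincaré inequality fails as soon as, along `s = κ e^{-B n}`, the rate function is
negligible against the inverse tail at `n` while the tail at `3 n` is at least `e^{-n B n}`. -/
theorem not_super_poincare_of_tails {d : ℕ} (hd : 1 ≤ d) {α : ℝ} (hα : α < 2) (V : Ed d → ℝ)
    [IsFiniteMeasure (muV d V)] {β : ℝ → ℝ} (hβ : ∀ s, 0 < s → 0 < β s) {c : ℝ} (hc : 0 < c)
    (B : ℕ → ℝ)
    (hlow : ∀ᶠ n : ℕ in atTop, c * Real.exp (-(n * B n)) ≤ (muV d V).real {x | 3 * (n : ℝ) < ‖x‖})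
    (hsmall : ∀ κ : ℝ, 0 < κ → ∀ᶠ n : ℕ in atTop,
      β (κ * Real.exp (-B n)) * (muV d V).real {x | (n : ℝ) < ‖x‖} ≤ Real.exp (-B n - 1) / 2) :
    ¬ ∀ s : ℝ, 0 < s → ∀ f : Ed d → ℝ, CbSmooth d f →
      ∫ x, (f x) ^ 2 ∂(muV d V) ≤ s * formE d α V f + β s * (∫ x, |f x| ∂(muV d V)) ^ 2 := by
  intro h
  obtain ⟨C, hC, hrec⟩ := exists_tail_recursion hd hα V hβ h
  set T : ℝ → ℝ := fun r => (muV d V).real {x | r < ‖x‖} with hT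
  have hκ : 0 < Real.exp (-1) / (2 * C) := by positivity
  have hexp : Tendsto (fun n : ℕ => T 0 * Real.exp (-(n : ℝ))) atTop (nhds 0) := by
    simpa using (tendsto_exp_neg_atTop_nhds_zero.comp tendsto_natCast_atTop_atTop).const_mul (T 0)
  obtain ⟨n, hn1, hn2, hn3⟩ :=
    (hlow.and ((hsmall _ hκ).and (hexp.eventually_lt_const hc))).exists
  set s := Real.exp (-1) / (2 * C) * Real.exp (-B n) with hs
  have hs0 : 0 < s := by positivity
  have hsC : s * C = Real.exp (-B n - 1) / 2 := by
    rw [hs, sub_eq_add_neg, Real.exp_add]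
    field_simp
  have hdecay := tail_geometric_decay (T := T) (fun _ => measureReal_nonneg) (antitone_tail V)
    (a := s * C) (b := β s) (r := n) (by positivity) (hβ s hs0) n.cast_nonneg
    (fun R hR => hrec R s hR hs0) (by rw [hsC]; exact hn2) n
  rw [show (n : ℝ) + 2 * n = 3 * n by ring, hsC,
    show 2 * (Real.exp (-B n - 1) / 2) = Real.exp (-B n - 1) by ring, ← Real.exp_nat_mul] at hdecay
  have h0 : T n ≤ T 0 := antitone_tail V n.cast_nonneg
  have h1 : c * Real.exp (-(n * B n)) ≤ T 0 * Real.exp (-(n : ℝ)) * Real.exp (-(n * B n)) :=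
    calc _ ≤ _ := hn1
      _ ≤ _ := hdecay
      _ ≤ Real.exp (n * (-B n - 1)) * T 0 := mul_le_mul_of_nonneg_left h0 (exp_pos _).le
      _ = _ := by
        rw [mul_assoc, ← Real.exp_add, mul_comm]
        ring_nf
  exact absurd (le_of_mul_le_mul_right h1 (exp_pos _)) (not_le.2 hn3)

theorem integrable_exp_neg_Vtheta (d : ℕ) (θ : ℝ) :
    Integrable fun x : Ed d => Real.exp (-Vtheta d θ x) := by
  refine integrable_exp_neg_norm d (u := fun t => t * Real.log (1 + t) ^ θ) (by fun_prop)
    (fun t ht => mul_nonneg ht (rpow_nonneg (Real.log_nonneg (by linarith)) _)) ?_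
  have h := ((isLittleO_log_rpow_rpow_atTop (1 - θ) one_pos).comp_tendsto
    (tendsto_atTop_add_const_left atTop (1 : ℝ) tendsto_id)).bound
      (c := 1 / (2 * (d + 1))) (by positivity)
  filter_upwards [h, eventually_ge_atTop 1] with t ht ht1
  have hl : 0 < Real.log (1 + t) := Real.log_pos (by linarith)
  simp only [Function.comp_apply, id, rpow_one] at ht
  rw [norm_of_nonneg (rpow_nonneg hl.le _), norm_of_nonneg (by linarith), rpow_sub hl, rpow_one,
    div_le_iff₀ (by positivity)] at ht
  have hd : (0 : ℝ) < d + 1 := by positivity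
  have h2 : (d + 1 : ℝ) * Real.log (1 + t) ≤ (1 + t) / 2 * Real.log (1 + t) ^ θ := by
    calc (d + 1 : ℝ) * Real.log (1 + t)
        ≤ (d + 1) * (1 / (2 * (d + 1)) * (1 + t) * Real.log (1 + t) ^ θ) := by gcongr
      _ = _ := by field_simp
  exact h2.trans (mul_le_mul_of_nonneg_right (by linarith) (rpow_nonneg hl.le _))

theorem not_super_poincare_Vtheta_of_nonpos {d : ℕ} (hd : 1 ≤ d) {α : ℝ} (hα : α < 2) {θ : ℝ}
    (hθ : θ ≤ 0) {β : ℝ → ℝ} (hβ : ∀ s, 0 < s → 0 < β s) :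
    ¬ ∀ s : ℝ, 0 < s → ∀ f : Ed d → ℝ, CbSmooth d f →
      ∫ x, (f x) ^ 2 ∂(muV d (Vtheta d θ)) ≤ s * formE d α (Vtheta d θ) f +
        β s * (∫ x, |f x| ∂(muV d (Vtheta d θ))) ^ 2 := by
  have hV := integrable_exp_neg_Vtheta d θ
  have := isFiniteMeasure_muV hV
  obtain ⟨c, hc, hlow⟩ := exists_tail_lower_bound hd hV
  refine not_super_poincare_of_tails hd hα _ hβ hc (fun _ => 4) ?_ fun κ hκ => ?_
  · filter_upwards [eventually_ge_atTop 1] with n hn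
    have hn1 : (1 : ℝ) ≤ n := by exact_mod_cast hn
    refine hlow _ _ (by positivity) fun x hx1 hx2 => ?_
    have hl : 1 ≤ Real.log (1 + ‖x‖) := by
      rw [Real.le_log_iff_exp_le (by positivity)]
      linarith [Real.exp_one_lt_d9]
    have h1 := mul_le_mul_of_nonneg_left (rpow_le_one_of_one_le_of_nonpos hl hθ) (norm_nonneg x)
    unfold Vtheta
    linarith
  · have h := (tendsto_tail (Vtheta d θ)).const_mul (β (κ * Real.exp (-4)))
    rw [mul_zero] at h
    exact h.eventually_le_const (by positivity)

theorem exists_tail_upper_bound_Vtheta (d : ℕ) {θ : ℝ} (hθ : 0 ≤ θ) : ∃ D : ℝ, 0 < D ∧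
    ∀ R : ℝ, 2 ≤ R →
      (muV d (Vtheta d θ)).real {x | R < ‖x‖} ≤ D * Real.exp (-(R / 2)) := by
  have hV := integrable_exp_neg_Vtheta d θ
  have hI : Integrable fun x : Ed d => Real.exp (-(‖x‖ / 2)) := by
    refine integrable_exp_neg_norm d (u := fun t => t / 2) (by fun_prop)
      (fun t ht => by positivity) ?_
    have h := ((isLittleO_log_rpow_rpow_atTop 1 one_pos).comp_tendsto
      (tendsto_atTop_add_const_left atTop (1 : ℝ) tendsto_id)).bound
        (c := 1 / (4 * (d + 1))) (by positivity)
    filter_upwards [h, eventually_ge_atTop 1] with t ht ht1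
    simp only [Function.comp_apply, id, rpow_one] at ht
    rw [norm_of_nonneg (Real.log_nonneg (by linarith)), norm_of_nonneg (by linarith)] at ht
    calc (d + 1 : ℝ) * Real.log (1 + t) ≤ (d + 1) * (1 / (4 * (d + 1)) * (1 + t)) := by gcongr
      _ = (1 + t) / 4 := by field_simp
      _ ≤ t / 2 := by linarith
  have hZ : 0 < (∫ y, Real.exp (-Vtheta d θ y))⁻¹ := inv_pos.2 (integral_exp_pos hV)
  have hJ : 0 < ∫ x : Ed d, Real.exp (-(‖x‖ / 2)) := integral_exp_pos hI
  refine ⟨(∫ y, Real.exp (-Vtheta d θ y))⁻¹ * ∫ x : Ed d, Real.exp (-(‖x‖ / 2)), by positivity,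
    fun R hR => ?_⟩
  rw [muV_real_apply hV (measurableSet_norm_gt R), mul_assoc]
  refine mul_le_mul_of_nonneg_left ?_ hZ.le
  rw [← integral_mul_const]
  refine le_trans (setIntegral_mono_on hV.integrableOn (hI.mul_const _).integrableOn
    (measurableSet_norm_gt R) fun x hx => ?_) (setIntegral_le_integral (hI.mul_const _)
      (.of_forall fun x => by positivity))
  have hx' : R < ‖x‖ := hx
  have hl : 1 ≤ Real.log (1 + ‖x‖) := by
    rw [Real.le_log_iff_exp_le (by positivity)]
    linarith [Real.exp_one_lt_d9]
  have h1 := mul_le_mul_of_nonneg_left (one_le_rpow hl hθ) (norm_nonneg x)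
  rw [← Real.exp_add]
  refine Real.exp_le_exp.2 ?_
  unfold Vtheta
  linarith

theorem le_exp_sqrt_of_log_log_le {b t : ℝ} (hb : 0 < b) (ht : 0 < t)
    (h : Real.log (Real.log b) ≤ 1 / 2 * Real.log t) : b ≤ Real.exp (√t) := by
  rw [← Real.log_le_iff_le_exp hb]
  rcases le_or_gt (Real.log b) 0 with h0 | h0
  · exact h0.trans (Real.sqrt_nonneg t)
  · rwa [← Real.log_le_log_iff h0 (Real.sqrt_pos.2 ht), Real.log_sqrt ht.le, ← one_div_mul_eq_div]

/-- If `log log β(s) = o(log^{1/θ}(1 + s⁻¹))`, then `β` grows at most like `e^{√n}` along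
`s = κ exp(-A log^θ n)`. -/
theorem eventually_rate_le_exp_sqrt {θ : ℝ} (hθ : 0 < θ) {β : ℝ → ℝ} (hβ : ∀ s, 0 < s → 0 < β s)
    (hlim : Tendsto (fun s : ℝ => Real.log (Real.log (β s)) / Real.log (1 + s⁻¹) ^ (1 / θ))
      (nhdsWithin 0 (Ioi 0)) (nhds 0)) {A κ : ℝ} (hA : 0 < A) (hκ : 0 < κ) :
    ∀ᶠ n : ℕ in atTop,
      β (κ * Real.exp (-(A * Real.log n ^ θ))) ≤ Real.exp (√(n : ℝ)) := by
  have hB : Tendsto (fun n : ℕ => A * Real.log n ^ θ) atTop atTop :=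
    ((tendsto_rpow_atTop hθ).comp (tendsto_log_atTop.comp
      tendsto_natCast_atTop_atTop)).const_mul_atTop hA
  have hs : Tendsto (fun n : ℕ => κ * Real.exp (-(A * Real.log n ^ θ))) atTop
      (nhdsWithin 0 (Ioi 0)) := by
    refine tendsto_nhdsWithin_iff.2 ⟨?_, .of_forall fun n => by
      rw [mem_Ioi]
      positivity⟩
    simpa using (tendsto_exp_neg_atTop_nhds_zero.comp hB).const_mul κ
  have hQ : 0 < (2 * A) ^ (1 / θ) := by positivity
  filter_upwards [(hlim.comp hs).eventually_lt_const (u := 1 / (2 * (2 * A) ^ (1 / θ)))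
      (by positivity), (tendsto_exp_atTop.comp hB).eventually_ge_atTop (1 + κ⁻¹),
      eventually_ge_atTop 2] with n h1 h2 hn
  have hn2 : (2 : ℝ) ≤ n := by exact_mod_cast hn
  have hlogn : 0 < Real.log n := Real.log_pos (by linarith)
  have hs0 : 0 < κ * Real.exp (-(A * Real.log n ^ θ)) := by positivity
  refine le_exp_sqrt_of_log_log_le (hβ _ hs0) (by linarith) ?_
  simp only [Function.comp_apply] at h1 h2
  set s := κ * Real.exp (-(A * Real.log n ^ θ)) with hsdef
  have hL0 : 0 < Real.log (1 + s⁻¹) := Real.log_pos (by linarith [inv_pos.2 hs0])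
  have hκ' : 0 < κ⁻¹ := inv_pos.2 hκ
  have hL : Real.log (1 + s⁻¹) ≤ 2 * A * Real.log n ^ θ := by
    rw [Real.log_le_iff_le_exp (by positivity), hsdef, mul_inv, ← Real.exp_neg, neg_neg, mul_assoc,
      two_mul, Real.exp_add]
    nlinarith
  have hLθ : Real.log (1 + s⁻¹) ^ (1 / θ) ≤ (2 * A) ^ (1 / θ) * Real.log n := by
    refine (rpow_le_rpow hL0.le hL (by positivity)).trans_eq ?_
    rw [mul_rpow (by positivity) (by positivity), ← rpow_mul hlogn.le, mul_one_div_cancel hθ.ne',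
      rpow_one]
  rw [div_lt_iff₀ (by positivity)] at h1
  calc _ ≤ _ := h1.le
    _ ≤ 1 / (2 * (2 * A) ^ (1 / θ)) * ((2 * A) ^ (1 / θ) * Real.log n) := by gcongr
    _ = _ := by field_simp

theorem not_super_poincare_Vtheta_of_pos {d : ℕ} (hd : 1 ≤ d) {α : ℝ} (hα : α < 2) {θ : ℝ}
    (hθ : 0 < θ) {β : ℝ → ℝ} (hβ : ∀ s, 0 < s → 0 < β s)
    (hlim : Tendsto (fun s : ℝ => Real.log (Real.log (β s)) / Real.log (1 + s⁻¹) ^ (1 / θ))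
      (nhdsWithin 0 (Ioi 0)) (nhds 0)) :
    ¬ ∀ s : ℝ, 0 < s → ∀ f : Ed d → ℝ, CbSmooth d f →
      ∫ x, (f x) ^ 2 ∂(muV d (Vtheta d θ)) ≤ s * formE d α (Vtheta d θ) f +
        β s * (∫ x, |f x| ∂(muV d (Vtheta d θ))) ^ 2 := by
  have hV := integrable_exp_neg_Vtheta d θ
  have := isFiniteMeasure_muV hV
  obtain ⟨c, hc, hlow⟩ := exists_tail_lower_bound hd hV
  obtain ⟨D, hD, hup⟩ := exists_tail_upper_bound_Vtheta d hθ.le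
  have hA : (0 : ℝ) < 4 * 2 ^ θ := by positivity
  refine not_super_poincare_of_tails hd hα _ hβ hc (fun n => 4 * 2 ^ θ * Real.log n ^ θ) ?_
    fun κ hκ => ?_
  · filter_upwards [eventually_ge_atTop 4] with n hn
    have hn1 : (4 : ℝ) ≤ n := by exact_mod_cast hn
    refine hlow _ _ (by positivity) fun x hx1 hx2 => ?_
    have hl : Real.log (1 + ‖x‖) ≤ 2 * Real.log n := by
      have h := Real.log_le_log (show 0 < 1 + ‖x‖ by positivity)
        (show 1 + ‖x‖ ≤ (n : ℝ) ^ 2 by nlinarith)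
      rwa [Real.log_pow, Nat.cast_two] at h
    have hl0 : 0 ≤ Real.log (1 + ‖x‖) := Real.log_nonneg (by linarith [norm_nonneg x])
    have hn0 : 0 ≤ Real.log n := Real.log_nonneg (by linarith)
    calc Vtheta d θ x ≤ 4 * n * (2 * Real.log n) ^ θ :=
          mul_le_mul (by linarith) (rpow_le_rpow hl0 hl hθ.le) (rpow_nonneg hl0 _) (by positivity)
      _ = _ := by
        rw [mul_rpow zero_le_two hn0]
        ring
  · have hlog := ((isLittleO_log_rpow_rpow_atTop θ one_pos).comp_tendsto
      tendsto_natCast_atTop_atTop).bound (c := 1 / (8 * (4 * 2 ^ θ))) (by positivity)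
    have hconst : ∀ᶠ n : ℕ in atTop, Real.log (2 * D) + 1 ≤ 1 / 8 * (n : ℝ) :=
      (tendsto_natCast_atTop_atTop.const_mul_atTop (by norm_num)).eventually_ge_atTop _
    filter_upwards [eventually_rate_le_exp_sqrt hθ hβ hlim hA hκ, hlog, hconst,
      eventually_ge_atTop 64] with n h1 h3 h4 hn
    have hn1 : (64 : ℝ) ≤ n := by exact_mod_cast hn
    have hn2 : (2 : ℝ) ≤ n := by linarith
    have h2 : √(n : ℝ) ≤ 1 / 8 * n := Real.sqrt_le_iff.2 ⟨by positivity, by nlinarith⟩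
    have hn0 : 0 ≤ Real.log n := Real.log_nonneg (by linarith)
    simp only [Function.comp_apply, rpow_one] at h3
    rw [norm_of_nonneg (by positivity), norm_of_nonneg (by positivity)] at h3
    have h5 : 4 * 2 ^ θ * Real.log n ^ θ ≤ 1 / 8 * n := by
      calc 4 * 2 ^ θ * Real.log n ^ θ ≤ 4 * 2 ^ θ * (1 / (8 * (4 * 2 ^ θ)) * n) := by gcongr
        _ = _ := by field_simp
    have h6 : 2 * D * Real.exp (√(n : ℝ) - n / 2) ≤
        Real.exp (-(4 * 2 ^ θ * Real.log n ^ θ) - 1) := by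
      rw [← Real.exp_log (show 0 < 2 * D by positivity), ← Real.exp_add]
      exact Real.exp_le_exp.2 (by linarith)
    calc _ ≤ Real.exp (√(n : ℝ)) * (D * Real.exp (-((n : ℝ) / 2))) :=
          mul_le_mul h1 (hup n hn2) measureReal_nonneg (exp_pos _).le
      _ = 2 * D * Real.exp (√(n : ℝ) - n / 2) / 2 := by
        rw [sub_eq_add_neg, Real.exp_add]
        ring
      _ ≤ _ := by linarith

/-- sharpness for `μ_{V_θ}`: (i) for `θ ≤ 0` the super Poincaré inequality
fails for every decreasing rate function; (ii) for `θ > 0` it fails for every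
decreasing rate function with `lim_{s→0} log log β(s)/log^{1/θ}(1+s⁻¹) = 0`. -/
theorem super_poincare_Vtheta_sharp
    (d : ℕ) (hd : 1 ≤ d) (α : ℝ) (hα : 0 < α ∧ α < 2) (θ : ℝ) :
    (θ ≤ 0 → ∀ β : ℝ → ℝ, (∀ s, 0 < s → 0 < β s) →
      (∀ s t : ℝ, 0 < s → s ≤ t → β t ≤ β s) →
      ¬ (∀ s : ℝ, 0 < s → ∀ f : Ed d → ℝ, CbSmooth d f →
        ∫ x, (f x) ^ 2 ∂(muV d (Vtheta d θ)) ≤ s * formE d α (Vtheta d θ) f +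
          β s * (∫ x, |f x| ∂(muV d (Vtheta d θ))) ^ 2)) ∧
    (0 < θ → ∀ β : ℝ → ℝ, (∀ s, 0 < s → 0 < β s) →
      (∀ s t : ℝ, 0 < s → s ≤ t → β t ≤ β s) →
      Filter.Tendsto
        (fun s : ℝ => Real.log (Real.log (β s)) / Real.log (1 + s⁻¹) ^ (1/θ))
        (nhdsWithin 0 (Set.Ioi 0)) (nhds 0) →
      ¬ (∀ s : ℝ, 0 < s → ∀ f : Ed d → ℝ, CbSmooth d f →
        ∫ x, (f x) ^ 2 ∂(muV d (Vtheta d θ)) ≤ s * formE d α (Vtheta d θ) f +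
          β s * (∫ x, |f x| ∂(muV d (Vtheta d θ))) ^ 2)) := by
  exact ⟨fun hθ _ hβ _ => not_super_poincare_Vtheta_of_nonpos hd hα.2 hθ hβ,
    fun hθ _ hβ _ hlim => not_super_poincare_Vtheta_of_pos hd hα.2 hθ hβ hlim⟩
end
end
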